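/- Let d ≥ 2, let k ≥ 1 be an integer, let D > 0 and 0 < E ≤ 1, and let m ∈ L¹(ℝ^d) ∩ C^∞(ℝ^d) satisfy ‖m‖_{L^∞(ℝ^d)} ≤ D^{−k} E and ‖∂^γ m‖_{L^∞(ℝ^d)} ≤ D^{|γ|−k} for every multi-index γ ∈ ℤ_+^d. Let K be the inverse Fourier transform of m, and set W_l(x) = K(x) ϕ(2^{−l} D^{−1} x) for l ∈ ℤ. Then for every N ∈ ℕ and every ε ∈ (0,1) there is a constant C, depending only on d, k, N, ε and φ, such that for all l ∈ ℤ and all ξ ∈ ℝ^d, |\widehat{W_l}(ξ)| ≤ C 2^{−l(N+1)(1−ε)} D^{−k} E^ε. -/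

import Mathlib

open MeasureTheory Metric Filter Set
open scoped ENNReal NNReal FourierTransform Topology

noncomputable section

abbrev Ed (d : ℕ) : Type := EuclideanSpace ℝ (Fin d)

theorem iteratedDeriv_comp_add_smul {V : Type*} [NormedAddCommGroup V] [NormedSpace ℝ V]
    {f : V → ℂ} (hf : ContDiff ℝ (⊤ : ℕ∞) f) (x v : V) (n : ℕ) (t : ℝ) :
    iteratedDeriv n (fun s : ℝ => f (x + s • v)) t =
      iteratedFDeriv ℝ n f (x + t • v) (fun _ => v) := by
  have h1 : (fun s : ℝ => f (x + s • v)) =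
      (fun y => f (x + y)) ∘ (ContinuousLinearMap.toSpanSingleton ℝ v) := by
    ext s; simp
  have hf' : ContDiff ℝ (⊤ : ℕ∞) (fun y => f (x + y)) := hf.comp (by fun_prop)
  rw [iteratedDeriv_eq_iteratedFDeriv, h1, ContinuousLinearMap.iteratedFDeriv_comp_right _ hf' _
    (mod_cast le_top), iteratedFDeriv_comp_add_left]
  simp

/-- Taylor's formula of order `N` with a uniform bound on the derivative of order `N + 1`. -/
theorem norm_sub_taylor_le {V : Type*} [NormedAddCommGroup V] [NormedSpace ℝ V]
    {f : V → ℂ} (hf : ContDiff ℝ (⊤ : ℕ∞) f) (N : ℕ) {M : ℝ}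
    (hM : ∀ y, ‖iteratedFDeriv ℝ (N + 1) f y‖ ≤ M) (x v : V) :
    ‖f (x + v) - ∑ j ∈ Finset.range (N + 1),
        ((j.factorial : ℝ)⁻¹) • iteratedFDeriv ℝ j f x (fun _ => v)‖
      ≤ M * ‖v‖ ^ (N + 1) / N.factorial := by
  have hg : ContDiff ℝ (⊤ : ℕ∞) (fun s : ℝ => f (x + s • v)) := hf.comp (by fun_prop)
  have hw : ∀ n : ℕ, ∀ t ∈ Icc (0 : ℝ) 1,
      iteratedDerivWithin n (fun s : ℝ => f (x + s • v)) (Icc 0 1) t =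
        iteratedFDeriv ℝ n f (x + t • v) (fun _ => v) := by
    intro n t ht
    rw [iteratedDerivWithin_eq_iteratedDeriv (uniqueDiffOn_Icc zero_lt_one)
      (hg.of_le (mod_cast le_top)).contDiffAt ht, iteratedDeriv_comp_add_smul hf]
  have key := taylor_mean_remainder_bound (f := fun s : ℝ => f (x + s • v)) (a := 0) (b := 1)
    (x := 1) (n := N) (C := M * ‖v‖ ^ (N + 1)) zero_le_one
    (hg.of_le (by exact_mod_cast le_top)).contDiffOn (by simp) (by
      intro t ht
      rw [hw _ t ht]
      refine (ContinuousMultilinearMap.le_opNorm _ _).trans ?_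
      simp only [Finset.prod_const, Finset.card_univ, Fintype.card_fin]
      gcongr
      exact hM _)
  rw [taylor_within_apply] at key
  simp only [sub_zero, one_pow, mul_one, one_smul] at key
  refine le_trans (le_of_eq ?_) key
  congr 2
  refine Finset.sum_congr rfl fun j _ => ?_
  rw [hw j 0 (by simp)]
  simp

theorem integrable_multilinear_mul {V : Type*} [NormedAddCommGroup V] [InnerProductSpace ℝ V]
    [FiniteDimensional ℝ V] [MeasurableSpace V] [BorelSpace V] (Ψ : SchwartzMap V ℂ) (n : ℕ)
    (L : ContinuousMultilinearMap ℝ (fun _ : Fin n => V) ℂ) :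
    Integrable (fun v => L (fun _ => v) * Ψ v) := by
  refine ((Ψ.integrable_pow_mul volume n).const_mul ‖L‖).mono'
    (by
      have : Continuous fun v : V => L (fun _ => v) := L.cont.comp (by fun_prop)
      exact (this.mul Ψ.continuous).aestronglyMeasurable) (.of_forall fun v => ?_)
  rw [norm_mul, ← mul_assoc]
  gcongr
  simpa using L.le_opNorm (fun _ => v)

/-- A Schwartz function whose Fourier transform has vanishing `n`-th derivative at the origin
integrates to zero against homogeneous polynomials of degree `n`. -/
theorem integral_multilinear_mul_eq_zero {V : Type*} [NormedAddCommGroup V]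
    [InnerProductSpace ℝ V] [FiniteDimensional ℝ V] [MeasurableSpace V] [BorelSpace V]
    (Ψ : SchwartzMap V ℂ) (n : ℕ)
    (hΨ : iteratedFDeriv ℝ n (𝓕 (Ψ : V → ℂ)) 0 = 0)
    (L : ContinuousMultilinearMap ℝ (fun _ : Fin n => V) ℂ) :
    ∫ v, L (fun _ => v) * Ψ v = 0 := by
  have hmono : ∀ w : Fin n → V, ∫ v, ((∏ i, inner ℝ v (w i) : ℝ) : ℂ) * Ψ v = 0 := by
    intro w
    rw [Real.iteratedFDeriv_fourier (N := ⊤) (fun k _ => Ψ.integrable_pow_mul volume k)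
      Ψ.continuous.aestronglyMeasurable (mod_cast le_top)] at hΨ
    have h2 := congrArg (fun T => T w) hΨ
    rw [Real.fourier_eq] at h2
    simp only [inner_zero_right, neg_zero, AddChar.map_zero_eq_one, one_smul] at h2
    have h3 := (ContinuousMultilinearMap.integral_apply
      (VectorFourier.integrable_fourierPowSMulRight (innerSL ℝ) (Ψ.integrable_pow_mul volume n)
        Ψ.continuous.aestronglyMeasurable) w).symm.trans h2
    simp only [VectorFourier.fourierPowSMulRight_apply, zero_apply] at h3
    rw [integral_smul, smul_eq_zero] at h3
    have h4 := h3.resolve_left (pow_ne_zero _ (by simp [Real.pi_ne_zero]))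
    simp only [Complex.real_smul] at h4
    exact h4
  let b := stdOrthonormalBasis ℝ V
  have hexp : ∀ v, L (fun _ => v) * Ψ v = ∑ r : Fin n → Fin (Module.finrank ℝ V),
      L (fun i => b (r i)) * (((∏ i, inner ℝ v (b (r i)) : ℝ) : ℂ) * Ψ v) := by
    intro v
    have hv : v = ∑ i, (inner ℝ v (b i) : ℝ) • b i := by
      conv_lhs => rw [← b.sum_repr' v]
      simp_rw [real_inner_comm]
    have : L (fun _ => v) = ∑ r : Fin n → Fin (Module.finrank ℝ V),
        (∏ i, inner ℝ v (b (r i)) : ℝ) • L (fun i => b (r i)) := by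
      conv_lhs => rw [hv]
      rw [ContinuousMultilinearMap.map_sum]
      simp_rw [ContinuousMultilinearMap.map_smul_univ]
    rw [this, Finset.sum_mul]
    refine Finset.sum_congr rfl fun r _ => ?_
    rw [Complex.real_smul]; ring
  simp_rw [hexp]
  rw [integral_finsetSum]
  · simp_rw [integral_const_mul, hmono]; simp
  · intro r _
    refine Integrable.const_mul ?_ _
    convert integrable_multilinear_mul Ψ n
      (Complex.ofRealCLM.compContinuousMultilinearMap
        ((ContinuousMultilinearMap.mkPiAlgebra ℝ (Fin n) ℝ).compContinuousLinearMap
          (fun i => innerSL ℝ (b (r i))))) using 2 with v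
    simp [real_inner_comm]

/-- The Taylor polynomial of `m` is annihilated by a Schwartz function all of whose moments up to
order `N` vanish. -/
theorem norm_integral_comp_mul_le {V : Type*} [NormedAddCommGroup V]
    [InnerProductSpace ℝ V] [FiniteDimensional ℝ V] [MeasurableSpace V] [BorelSpace V]
    (Ψ : SchwartzMap V ℂ) (hΨ : ∀ n, iteratedFDeriv ℝ n (𝓕 (Ψ : V → ℂ)) 0 = 0)
    {m : V → ℂ} (hm : ContDiff ℝ (⊤ : ℕ∞) m) (N : ℕ) {B M : ℝ} (hB : ∀ y, ‖m y‖ ≤ B)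
    (hM : ∀ y, ‖iteratedFDeriv ℝ (N + 1) m y‖ ≤ M) {a : ℝ} (ha : 0 < a) (ξ : V) :
    ‖∫ v, m (ξ - a • v) * Ψ v‖ ≤
      M * a ^ (N + 1) / N.factorial * ∫ v, ‖v‖ ^ (N + 1) * ‖Ψ v‖ := by
  let P : V → ℂ := fun v => ∑ j ∈ Finset.range (N + 1),
        ((j.factorial : ℝ)⁻¹) • iteratedFDeriv ℝ j m ξ (fun _ => (-a) • v)
  have hPmul : ∀ v, P v * Ψ v = ∑ j ∈ Finset.range (N + 1),
      (((j.factorial : ℝ)⁻¹ * (-a) ^ j : ℝ) : ℂ) *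
        (iteratedFDeriv ℝ j m ξ (fun _ => v) * Ψ v) := by
    intro v
    simp only [P, Finset.sum_mul]
    refine Finset.sum_congr rfl fun j _ => ?_
    rw [ContinuousMultilinearMap.map_smul_univ _ (fun _ => -a) (fun _ => v)]
    simp only [Finset.prod_const, Finset.card_univ, Fintype.card_fin, Complex.real_smul]
    push_cast
    ring
  have hPint : Integrable (fun v => P v * Ψ v) := by
    simp_rw [hPmul]
    exact integrable_finsetSum _ fun j _ => (integrable_multilinear_mul Ψ j _).const_mul _
  have hP0 : ∫ v, P v * Ψ v = 0 := by
    simp_rw [hPmul]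
    rw [integral_finsetSum _ fun j _ => (integrable_multilinear_mul Ψ j _).const_mul _]
    simp_rw [integral_const_mul, integral_multilinear_mul_eq_zero Ψ _ (hΨ _)]
    simp
  have hmint : Integrable (fun v => m (ξ - a • v) * Ψ v) := by
    refine Ψ.integrable.bdd_mul (c := B) ?_ (.of_forall fun v => hB _)
    exact (hm.continuous.comp (by fun_prop)).aestronglyMeasurable
  have hsub : ∫ v, m (ξ - a • v) * Ψ v = ∫ v, (m (ξ - a • v) - P v) * Ψ v := by
    simp_rw [sub_mul]
    rw [integral_sub hmint hPint, hP0, sub_zero]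
  rw [hsub, ← integral_const_mul]
  refine norm_integral_le_of_norm_le ((Ψ.integrable_pow_mul volume (N + 1)).const_mul _)
    (.of_forall fun v => ?_)
  rw [norm_mul, ← mul_assoc]
  gcongr
  have h := norm_sub_taylor_le hm N hM ξ ((-a) • v)
  rw [norm_smul, norm_neg, Real.norm_of_nonneg ha.le, neg_smul, ← sub_eq_add_neg] at h
  refine (le_of_eq ?_).trans (h.trans (le_of_eq ?_))
  · simp [P]
  · rw [mul_pow]; ring

theorem fourier_comp_smul {V F : Type*} [NormedAddCommGroup V]
    [InnerProductSpace ℝ V] [FiniteDimensional ℝ V] [MeasurableSpace V] [BorelSpace V]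
    [NormedAddCommGroup F] [NormedSpace ℂ F]
    (f : V → F) {a : ℝ} (ha : 0 < a) (w : V) :
    𝓕 (fun x => f (a • x)) w = (a ^ Module.finrank ℝ V)⁻¹ • 𝓕 f (a⁻¹ • w) := by
  rw [Real.fourier_eq, Real.fourier_eq]
  have h := Measure.integral_comp_smul_of_nonneg (volume : Measure V)
    (fun x => Real.fourierChar (-inner ℝ x (a⁻¹ • w)) • f x) a (hR := ha.le)
  rw [← h]
  congr 1 with x
  rw [inner_smul_left, inner_smul_right]
  simp [ha.ne']

/-- The Fourier transform of `m^∨` times a dilated function is the corresponding average of `m`. -/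
theorem fourier_fourierInv_mul_comp_smul {V : Type*} [NormedAddCommGroup V]
    [InnerProductSpace ℝ V] [FiniteDimensional ℝ V] [MeasurableSpace V] [BorelSpace V]
    {m g : V → ℂ} (hm : Integrable m) (hg : Integrable g) {a : ℝ} (ha : 0 < a) (ξ : V) :
    𝓕 (fun x => 𝓕⁻ m x * g (a • x)) ξ = ∫ v, m (ξ - a • v) * 𝓕 g v := by
  have hga : Integrable (fun x => g (a • x)) := hg.comp_smul ha.ne'
  let G : V → ℂ := fun x => Real.fourierChar (inner ℝ x ξ) • g (a • (-x))
  have hG : Integrable G := by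
    have := (Real.fourierIntegral_convergent_iff (f := fun x => g (a • (-x))) (-ξ)).2 hga.comp_neg
    simpa [G] using this
  have hGF : ∀ η, 𝓕 G η = 𝓕 (fun x => g (a • x)) (ξ - η) := by
    intro η
    rw [Real.fourier_eq, Real.fourier_eq, ← integral_neg_eq_self]
    congr 1 with x
    simp only [G, neg_neg, smul_smul, ← AddChar.map_add_eq_mul]
    congr 2
    simp [inner_sub_right, ← sub_eq_add_neg]
  have hflip : ∫ x, 𝓕 m x * G x = ∫ η, m η * 𝓕 G η := by
    simpa using! (VectorFourier.integral_fourierIntegral_smul_eq_flip (L := innerₗ V)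
      Real.continuous_fourierChar continuous_inner hm hG)
  calc 𝓕 (fun x => 𝓕⁻ m x * g (a • x)) ξ
      = ∫ x, 𝓕 m x * G x := by
        rw [Real.fourier_eq, ← integral_neg_eq_self]
        congr 1 with x
        simp only [G, Real.fourierInv_eq_fourier_neg, neg_neg, inner_neg_left, smul_neg,
          Circle.smul_def, smul_eq_mul]
        ring
    _ = ∫ η, m η * 𝓕 (fun x => g (a • x)) (ξ - η) := by simp_rw [hflip, hGF]
    _ = ∫ ζ, m (ξ - ζ) * 𝓕 (fun x => g (a • x)) ζ := by
        rw [← integral_sub_left_eq_self _ volume ξ]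
        simp
    _ = (a ^ Module.finrank ℝ V)⁻¹ • ∫ ζ, m (ξ - a • a⁻¹ • ζ) * 𝓕 g (a⁻¹ • ζ) := by
        rw [← integral_smul]
        congr 1 with ζ
        rw [fourier_comp_smul g ha, smul_inv_smul₀ ha.ne', mul_smul_comm]
    _ = ∫ v, m (ξ - a • v) * 𝓕 g v := by
        rw [Measure.integral_comp_inv_smul_of_nonneg volume
          (fun v => m (ξ - a • v) * 𝓕 g v) ha.le, smul_smul,
          inv_mul_cancel₀ (pow_ne_zero _ ha.ne'), one_smul]

/-- Fourier transform estimate for the dyadic pieces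
`W_l(x) = K(x) ϕ(2^{-l} D^{-1} x)` of the kernel `K = m^∨`:
`|Ŵ_l(ξ)| ≤ C 2^{-l(N+1)(1-ε)} D^{-k} E^ε`, with `C` independent of `D`, `E`, `m`, `l`. -/
theorem fourier_estimate_Wl
    (d k : ℕ) (hd : 2 ≤ d) (hk : 1 ≤ k)
    (φ : Ed d → ℝ) (hφsm : ContDiff ℝ (⊤ : ℕ∞) φ)
    (hφsupp : tsupport φ ⊆ ball (0 : Ed d) 2)
    (hφone : ∀ x : Ed d, ‖x‖ ≤ 1 → φ x = 1)
    (hφrad : ∀ x y : Ed d, ‖x‖ = ‖y‖ → φ x = φ y)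
    (N : ℕ) (ε : ℝ) (hε₀ : 0 < ε) (hε₁ : ε < 1) :
    ∃ C : ℝ, 0 < C ∧ ∀ D E : ℝ, 0 < D → 0 < E → E ≤ 1 →
      ∀ m : Ed d → ℂ, Integrable m volume → ContDiff ℝ (⊤ : ℕ∞) m →
      (∀ ξ : Ed d, ‖m ξ‖ ≤ D ^ (-(k : ℝ)) * E) →
      (∀ (γ : ℕ) (ξ : Ed d), ‖iteratedFDeriv ℝ γ m ξ‖ ≤ D ^ ((γ : ℝ) - (k : ℝ))) →
      ∀ (l : ℤ) (ξ : Ed d),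
        ‖𝓕 (fun x : Ed d => 𝓕⁻ m x *
            ((φ (((2 : ℝ) ^ (-l) * D⁻¹) • x) - φ (((2 : ℝ) ^ (1 - l) * D⁻¹) • x) : ℝ) : ℂ)) ξ‖
          ≤ C * (2 : ℝ) ^ (-(l : ℝ) * ((N : ℝ) + 1) * (1 - ε)) * D ^ (-(k : ℝ)) * E ^ ε := by
  let f : Ed d → ℂ := fun x => ((φ x - φ ((2 : ℝ) • x) : ℝ) : ℂ)
  have hφc : HasCompactSupport φ :=
    HasCompactSupport.of_support_subset_isCompact (isCompact_closedBall (0 : Ed d) 2)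
      ((subset_tsupport φ).trans (hφsupp.trans ball_subset_closedBall))
  have hfc : HasCompactSupport f := by
    have h2 : HasCompactSupport (fun x : Ed d => φ ((2 : ℝ) • x)) := hφc.comp_smul two_ne_zero
    exact (hφc.sub h2).comp_left (g := ((↑) : ℝ → ℂ)) Complex.ofReal_zero
  have hfs : ContDiff ℝ (⊤ : ℕ∞) f :=
    Complex.ofRealCLM.contDiff.comp (hφsm.sub (hφsm.comp (contDiff_const_smul (2 : ℝ))))
  let S : SchwartzMap (Ed d) ℂ := hfc.toSchwartzMap hfs
  let Ψ : SchwartzMap (Ed d) ℂ := 𝓕 S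
  have hSf : (S : Ed d → ℂ) = f := rfl
  have hΨf : (Ψ : Ed d → ℂ) = 𝓕 f := SchwartzMap.fourier_coe S
  have hf0 : f =ᶠ[𝓝 0] fun _ => 0 := by
    filter_upwards [ball_mem_nhds (0 : Ed d) (show (0 : ℝ) < 1 / 2 by norm_num)] with x hx
    rw [mem_ball_zero_iff] at hx
    have h2 : ‖(2 : ℝ) • x‖ ≤ 1 := by
      rw [norm_smul, Real.norm_two]; linarith
    simp [f, hφone x (by linarith), hφone _ h2]
  have hΨ : ∀ n, iteratedFDeriv ℝ n (𝓕 (Ψ : Ed d → ℂ)) 0 = 0 := by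
    intro n
    have h1 : 𝓕 (Ψ : Ed d → ℂ) = fun x => f (-x) := by
      ext x
      have h2 : 𝓕⁻ (Ψ : Ed d → ℂ) (-x) = f (-x) := by
        rw [← SchwartzMap.fourierInv_coe, FourierTransform.fourierInv_fourier_eq, hSf]
      rw [← h2, Real.fourierInv_eq_fourier_neg, neg_neg]
    have h3 : 𝓕 (Ψ : Ed d → ℂ) =ᶠ[𝓝 0] fun _ => 0 := by
      rw [h1]
      have : Tendsto (fun x : Ed d => -x) (𝓝 0) (𝓝 0) := by
        simpa using (continuous_neg (G := Ed d)).tendsto 0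
      exact this.eventually hf0
    rw [(h3.iteratedFDeriv ℝ n).eq_of_nhds]
    simp
  set A : ℝ := ∫ v, ‖Ψ v‖ with hA
  set B : ℝ := ∫ v, ‖v‖ ^ (N + 1) * ‖Ψ v‖ with hB
  have hA0 : 0 ≤ A := integral_nonneg fun v => by positivity
  have hB0 : 0 ≤ B := integral_nonneg fun v => by positivity
  refine ⟨A + B + 1, by positivity, ?_⟩
  intro D E hD hE _ m hmi hms hm0 hmder l ξ
  set a : ℝ := (2 : ℝ) ^ (-l) * D⁻¹ with ha_def
  have ha : 0 < a := by positivity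
  have hfun : (fun x : Ed d => 𝓕⁻ m x *
      ((φ (((2 : ℝ) ^ (-l) * D⁻¹) • x) - φ (((2 : ℝ) ^ (1 - l) * D⁻¹) • x) : ℝ) : ℂ)) =
      fun x => 𝓕⁻ m x * f (a • x) := by
    ext x
    have : (2 : ℝ) ^ (1 - l) * D⁻¹ = 2 * a := by
      rw [ha_def, sub_eq_add_neg, zpow_add₀ two_ne_zero, zpow_one, mul_assoc]
    simp only [f, smul_smul, this, ← ha_def]
  rw [hfun, fourier_fourierInv_mul_comp_smul hmi
    (hSf ▸ S.integrable) ha, ← hΨf]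
  set X : ℝ := ‖∫ v, m (ξ - a • v) * Ψ v‖ with hX
  have hX0 : 0 ≤ X := norm_nonneg _
  have hX1 : X ≤ (A + B + 1) * (D ^ (-(k : ℝ)) * E) := by
    have h : X ≤ (D ^ (-(k : ℝ)) * E) * A := by
      rw [hA, ← integral_const_mul]
      refine norm_integral_le_of_norm_le (Ψ.integrable.norm.const_mul _) (.of_forall fun v => ?_)
      rw [norm_mul]
      gcongr
      exact hm0 _
    have : 0 ≤ D ^ (-(k : ℝ)) * E := by positivity
    nlinarith
  have hX2 : X ≤ (A + B + 1) * (D ^ (-(k : ℝ)) * (2 : ℝ) ^ (-(l : ℝ) * ((N : ℝ) + 1))) := by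
    have h := norm_integral_comp_mul_le Ψ hΨ hms N hm0 (hmder (N + 1)) ha ξ
    have hDa : D ^ (((N + 1 : ℕ) : ℝ) - (k : ℝ)) * a ^ (N + 1) =
        D ^ (-(k : ℝ)) * (2 : ℝ) ^ (-(l : ℝ) * ((N : ℝ) + 1)) := by
      rw [sub_eq_add_neg, Real.rpow_add hD, Real.rpow_natCast, ha_def, mul_pow, inv_pow,
        Real.rpow_mul two_pos.le]
      have h1 : (2 : ℝ) ^ (-(l : ℝ)) = (2 : ℝ) ^ (-l) := by
        rw [← Real.rpow_intCast]; push_cast; rfl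
      have h2 : ((N : ℝ) + 1) = ((N + 1 : ℕ) : ℝ) := by push_cast; rfl
      rw [h1, h2, Real.rpow_natCast]
      field_simp
    rw [hDa] at h
    have hQ : 0 ≤ D ^ (-(k : ℝ)) * (2 : ℝ) ^ (-(l : ℝ) * ((N : ℝ) + 1)) := by positivity
    have h1 := div_le_self hQ (show (1 : ℝ) ≤ N.factorial by exact_mod_cast N.factorial_pos)
    have h2 := h.trans (mul_le_mul_of_nonneg_right h1 hB0)
    nlinarith
  have hC : 0 < A + B + 1 := by positivity
  calc X = X ^ ε * X ^ (1 - ε) := by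
        rw [← Real.rpow_add_of_nonneg hX0 hε₀.le (by linarith), add_sub_cancel, Real.rpow_one]
    _ ≤ ((A + B + 1) * (D ^ (-(k : ℝ)) * E)) ^ ε *
        ((A + B + 1) * (D ^ (-(k : ℝ)) * (2 : ℝ) ^ (-(l : ℝ) * ((N : ℝ) + 1)))) ^ (1 - ε) := by
        gcongr
    _ = _ := by
        have hG : 0 < (A + B + 1) * D ^ (-(k : ℝ)) := by positivity
        rw [← mul_assoc, ← mul_assoc, Real.mul_rpow hG.le hE.le,
          Real.mul_rpow hG.le (by positivity), mul_mul_mul_comm, ← Real.rpow_add hG,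
          add_sub_cancel, Real.rpow_one, ← Real.rpow_mul two_pos.le]
        ring
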